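/- Let a network N consist of M parties and N independent sources as above, where each party's input set contains a distinguished trivial input ∅ whose response is identically 1. Suppose for each index k in a finite family there are real coefficients β^{(k)} and a real bound L^{(k)} such that every N-local model satisfies Σ_{x¹,…,x^M} β^{(k)}_{x¹,…,x^M} ⟨a¹_{x¹}⋯a^M_{x^M}⟩ ≤ L^{(k)}. Form N′ by adding one new source S_{N+1} connected exactly to party A^M and to one new party A^{M+1} with binary inputs and outputs ±1. Then every N′-local model satisfies: either there exists a single q ∈ (0,1) such that for every k and every partition of party A^M's nontrivial inputs into disjoint subsets X₊ and X₋, (1/q)·Σ^{(k)}_{X₊} + (1/(1−q))·Σ^{(k)}_{X₋} + Σ^{(k)}_∅ ≤ L^{(k)}, where Σ^{(k)}_{X±} = Σ_{x¹,…,x^{M−1}, x^M ∈ X±} β^{(k)}_{x¹,…,x^M} ⟨a¹_{x¹}⋯a^M_{x^M}·(a^{M+1}_0 ± a^{M+1}_1)/2⟩ and Σ^{(k)}_∅ = Σ_{x¹,…,x^{M−1}} β^{(k)}_{x¹,…,x^{M−1},∅} ⟨a¹_{x¹}⋯a^{M−1}_{x^{M−1}}⟩; or for all k and all such partitions, Σ^{(k)}_{X₋}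 = 0 and Σ^{(k)}_{X₊} + Σ^{(k)}_∅ ≤ L^{(k)}; or for all k and all such partitions, Σ^{(k)}_{X₊} = 0 and Σ^{(k)}_{X₋} + Σ^{(k)}_∅ ≤ L^{(k)}. -/

import Mathlib

open MeasureTheory

/-- Fubini for a finite linear combination of correlators with a factor depending only on the
second variable. -/
lemma sum_mul_integral_prod_eq {Ω Ω' ι : Type*} [MeasurableSpace Ω] [MeasurableSpace Ω']
    (P : Measure Ω) [IsProbabilityMeasure P] (μ : Measure Ω') [IsProbabilityMeasure μ]
    (S : Finset ι) (c : ι → ℝ) (f : ι → Ω → Ω' → ℝ) (u : Ω' → ℝ)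
    (hf : ∀ i, Measurable fun p : Ω × Ω' => f i p.1 p.2) (hf1 : ∀ i ω m, |f i ω m| ≤ 1)
    (hu : Measurable u) (hu1 : ∀ m, |u m| ≤ 1) :
    Integrable (fun m => u m * ∑ i ∈ S, c i * ∫ ω, f i ω m ∂P) μ ∧
    ∑ i ∈ S, c i * ∫ p, f i p.1 p.2 * u p.2 ∂(P.prod μ)
      = ∫ m, u m * ∑ i ∈ S, c i * ∫ ω, f i ω m ∂P ∂μ := by
  have hint : ∀ i, Integrable (fun p : Ω × Ω' => f i p.1 p.2 * u p.2) (P.prod μ) := fun i =>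
    Integrable.of_bound ((hf i).mul (hu.comp measurable_snd)).aestronglyMeasurable 1
      (.of_forall fun p => by
        rw [Real.norm_eq_abs, abs_mul]
        exact mul_le_one₀ (hf1 i p.1 p.2) (abs_nonneg _) (hu1 p.2))
  have hsum : (fun m => u m * ∑ i ∈ S, c i * ∫ ω, f i ω m ∂P)
      = fun m => ∑ i ∈ S, c i * ∫ ω, f i ω m * u m ∂P := by
    ext m
    simp only [integral_mul_const, Finset.mul_sum]
    exact Finset.sum_congr rfl fun i _ => by ring
  have hi : ∀ i ∈ S, Integrable (fun m => c i * ∫ ω, f i ω m * u m ∂P) μ := fun i _ =>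
    (hint i).integral_prod_right.const_mul (c i)
  rw [hsum]
  refine ⟨integrable_finsetSum S hi, ?_⟩
  rw [integral_finsetSum S hi]
  refine Finset.sum_congr rfl fun i _ => ?_
  rw [integral_const_mul, integral_prod_symm _ (hint i)]

/-- If `|G m| + |H m'| + C ≤ 0` for all `m`, `m'`, then the same holds with `G`, `H` averaged
over the disjoint supports of the sign functions `u` and `v`. -/
lemma integral_sign_trichotomy {Ω : Type*} [MeasurableSpace Ω] (μ : Measure Ω)
    [IsProbabilityMeasure μ] (u v G H : Ω → ℝ) (C : ℝ) (hu : Measurable u) (hv : Measurable v)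
    (huv : ∀ m, |u m| = 1 ∧ v m = 0 ∨ u m = 0 ∧ |v m| = 1)
    (hG : Integrable (fun m => u m * G m) μ) (hH : Integrable (fun m => v m * H m) μ)
    (key : ∀ m m', |G m| + |H m'| + C ≤ 0) :
    ((∫ m, |u m| ∂μ) ∈ Set.Ioo (0 : ℝ) 1 →
      1 / (∫ m, |u m| ∂μ) * (∫ m, u m * G m ∂μ)
        + 1 / (1 - ∫ m, |u m| ∂μ) * (∫ m, v m * H m ∂μ) + C ≤ 0) ∧
    ((∫ m, |u m| ∂μ) = 1 → (∫ m, v m * H m ∂μ) = 0 ∧ (∫ m, u m * G m ∂μ) + C ≤ 0) ∧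
    ((∫ m, |u m| ∂μ) = 0 → (∫ m, u m * G m ∂μ) = 0 ∧ (∫ m, v m * H m ∂μ) + C ≤ 0) := by
  have iu : Integrable (fun m => |u m|) μ := Integrable.of_bound hu.abs.aestronglyMeasurable 1
    (.of_forall fun m => by rcases huv m with h | h <;> simp [h])
  have iv : Integrable (fun m => |v m|) μ := Integrable.of_bound hv.abs.aestronglyMeasurable 1
    (.of_forall fun m => by rcases huv m with h | h <;> simp [h])
  have hv_int : ∫ m, |v m| ∂μ = 1 - ∫ m, |u m| ∂μ := by
    have h : (fun m => |v m|) = fun m => 1 - |u m| := by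
      ext m; rcases huv m with h | h <;> simp [h]
    rw [h, integral_sub (integrable_const _) iu]; simp
  have pu : ∀ m m', u m * G m + |u m| * (|H m'| + C) ≤ 0 := fun m m' => by
    rcases huv m with h | h
    · have := le_abs_self (u m * G m)
      rw [abs_mul] at this
      have := key m m'
      simp only [h] at *; linarith
    · simp [h]
  have pv : ∀ m m', v m' * H m' + |v m'| * (|G m| + C) ≤ 0 := fun m m' => by
    rcases huv m' with h | h
    · simp [h]
    · have := le_abs_self (v m' * H m')
      rw [abs_mul] at this
      have := key m m'
      simp only [h] at *; linarith
  set q := ∫ m, |u m| ∂μ with hq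
  have qu : ∀ m', (∫ m, u m * G m ∂μ) + q * (|H m'| + C) ≤ 0 := fun m' => by
    rw [hq, ← integral_mul_const, ← integral_add hG (iu.mul_const _)]
    exact integral_nonpos fun m => pu m m'
  have qv : ∀ m, (∫ m', v m' * H m' ∂μ) + (1 - q) * (|G m| + C) ≤ 0 := fun m => by
    rw [← hv_int, ← integral_mul_const, ← integral_add hH (iv.mul_const _)]
    exact integral_nonpos fun m' => pv m m'
  have m₀ : Ω := (nonempty_of_isProbabilityMeasure μ).some
  have null : ∀ w F : Ω → ℝ, Integrable (fun m => |w m|) μ → ∫ m, |w m| ∂μ = 0 →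
      ∫ m, w m * F m ∂μ = 0 := fun w F iw h0 => by
    have h := (integral_eq_zero_iff_of_nonneg (fun m => abs_nonneg (w m)) iw).1 h0
    refine integral_eq_zero_of_ae ?_
    filter_upwards [h] with m hm
    simp [abs_eq_zero.1 hm]
  refine ⟨fun ⟨h0, h1⟩ => ?_, fun h1 => ⟨null v H iv (by rw [hv_int, h1, sub_self]), ?_⟩,
    fun h0 => ⟨null u G iu h0, ?_⟩⟩
  · have h1' : 0 < 1 - q := by linarith
    have step : ∀ m', |v m'| * (∫ m, u m * G m ∂μ) + q * (v m' * H m')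
        + |v m'| * (q * C) ≤ 0 := fun m' => by
      have h2 := mul_nonpos_of_nonneg_of_nonpos (abs_nonneg (v m')) (qu m')
      have h3 := mul_le_mul_of_nonneg_left (le_abs_self (v m' * H m')) h0.le
      rw [abs_mul] at h3
      linarith
    have h := integral_nonpos (μ := μ) step
    have i : Integrable (fun m' => |v m'| * (∫ m, u m * G m ∂μ) + q * (v m' * H m')) μ :=
      (iv.mul_const _).add (hH.const_mul _)
    rw [integral_add i (iv.mul_const _),
      integral_add (iv.mul_const _) (hH.const_mul _), integral_mul_const, integral_const_mul,
      integral_mul_const, hv_int] at h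
    have e : 1 / q * (∫ m, u m * G m ∂μ) + 1 / (1 - q) * (∫ m, v m * H m ∂μ) + C
        = ((1 - q) * (∫ m, u m * G m ∂μ) + q * (∫ m, v m * H m ∂μ) + (1 - q) * (q * C))
          / (q * (1 - q)) := by
      field_simp
    rw [e]
    exact div_nonpos_of_nonpos_of_nonneg h (by positivity)
  · have := qu m₀
    have := abs_nonneg (H m₀)
    rw [h1] at *; linarith
  · have := qv m₀
    have := abs_nonneg (G m₀)
    rw [h0] at *; linarith

lemma half_sum_half_diff_sign {x y : ℝ} (hx : x = 1 ∨ x = -1) (hy : y = 1 ∨ y = -1) :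
    |(x + y) / 2| = 1 ∧ (x - y) / 2 = 0 ∨ (x + y) / 2 = 0 ∧ |(x - y) / 2| = 1 := by
  rcases hx with rfl | rfl <;> rcases hy with rfl | rfl <;> norm_num

lemma abs_add_abs_add_le {g h c l : ℝ}
    (H : ∀ σ τ : ℝ, (σ = 1 ∨ σ = -1) → (τ = 1 ∨ τ = -1) → σ * g + τ * h + c ≤ l) :
    |g| + |h| + (c - l) ≤ 0 := by
  have h1 := H 1 1 (by simp) (by simp)
  have h2 := H 1 (-1) (by simp) (by simp)
  have h3 := H (-1) 1 (by simp) (by simp)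
  have h4 := H (-1) (-1) (by simp) (by simp)
  rcases abs_cases g with ⟨e, _⟩ | ⟨e, _⟩ <;> rcases abs_cases h with ⟨e', _⟩ | ⟨e', _⟩ <;>
    rw [e, e'] <;> linarith

/-- **Main theorem (general version, with marginal terms and a family of inequalities).**
Let a network `𝒩` consist of `M` parties (indexed by `Fin M`, with finite input sets `X j`
containing a distinguished trivial input `e j` whose response is identically `1`, and
±1-valued outputs) and `N` independent sources, `conn i j` meaning that source `i` is
connected to party `j`; `lastP` is the distinguished party `A^M`. Suppose that for each `k`
in a finite family `K` there are coefficients `β k` and a bound `L k` such that every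
`𝒩`-local model satisfies `∑_x β k x ⟨a¹_{x¹} ⋯ a^M_{x^M}⟩ ≤ L k`.
Form `𝒩′` by adding one new source (variable space `Μt`, measure `μ`) connected exactly to
party `A^M` and to one new party `A^{M+1}` with binary inputs and ±1-valued outputs `b`.
Then every `𝒩′`-local model satisfies: either there exists a single `q ∈ (0,1)` such that for
every `k` and every partition of `A^M`'s nontrivial inputs into `X₊ = s⁻¹(true)` and
`X₋ = s⁻¹(false)` one has `(1/q)·Σ^{(k)}_{X₊} + (1/(1−q))·Σ^{(k)}_{X₋} + Σ^{(k)}_∅ ≤ L k`,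
where `Σ^{(k)}_{X±} = ∑_{x, x^M ∈ X±} β k x ⟨a¹_{x¹} ⋯ a^M_{x^M} (a^{M+1}_0 ± a^{M+1}_1)/2⟩`
and `Σ^{(k)}_∅ = ∑_{x, x^M = ∅} β k x ⟨a¹_{x¹} ⋯ a^{M−1}_{x^{M−1}}⟩` (the factor of party
`A^M` being `a^M_∅ ≡ 1`); or for all `k` and all such partitions `Σ^{(k)}_{X₋} = 0` and
`Σ^{(k)}_{X₊} + Σ^{(k)}_∅ ≤ L k`; or for all `k` and all such partitions `Σ^{(k)}_{X₊} = 0`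
and `Σ^{(k)}_{X₋} + Σ^{(k)}_∅ ≤ L k`. -/
theorem network_bell_inequality_extension_general
    (M N : ℕ)
    (X : Fin M → Type) [∀ j, Fintype (X j)] [∀ j, DecidableEq (X j)]
    (e : ∀ j, X j)
    (conn : Fin N → Fin M → Prop)
    (lastP : Fin M) (hlast : (lastP : ℕ) + 1 = M)
    (K : Type) [Fintype K]
    (β : K → (∀ j, X j) → ℝ) (L : K → ℝ)
    (hBell : ∀ (Λ : Fin N → Type) [∀ i, MeasurableSpace (Λ i)]
      (ρ : ∀ i, Measure (Λ i)) [∀ i, IsProbabilityMeasure (ρ i)]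
      (a : ∀ j : Fin M, X j → (∀ i, Λ i) → ℝ),
      (∀ j x, Measurable (a j x)) →
      (∀ j x lam, a j x lam = 1 ∨ a j x lam = -1) →
      (∀ j lam, a j (e j) lam = 1) →
      (∀ j x lam lam', (∀ i, conn i j → lam i = lam' i) → a j x lam = a j x lam') →
      ∀ k : K, ∑ x : ∀ j, X j, β k x * ∫ lam, ∏ j, a j (x j) lam ∂(Measure.pi ρ) ≤ L k)
    -- an `𝒩′`-local model:
    (Λ : Fin N → Type) [∀ i, MeasurableSpace (Λ i)]
    (ρ : ∀ i, Measure (Λ i)) [∀ i, IsProbabilityMeasure (ρ i)]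
    (Μt : Type) [MeasurableSpace Μt] (μ : Measure Μt) [IsProbabilityMeasure μ]
    (a : ∀ j : Fin M, X j → (∀ i, Λ i) → Μt → ℝ)
    (b : Fin 2 → Μt → ℝ)
    (ha_meas : ∀ j x, Measurable (fun p : (∀ i, Λ i) × Μt => a j x p.1 p.2))
    (hb_meas : ∀ y, Measurable (b y))
    (ha_val : ∀ j x lam m, a j x lam m = 1 ∨ a j x lam m = -1)
    (ha_triv : ∀ j lam m, a j (e j) lam m = 1)
    (hb_val : ∀ y m, b y m = 1 ∨ b y m = -1)
    (ha_loc : ∀ j x lam lam' m m', (∀ i, conn i j → lam i = lam' i) →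
      (j = lastP → m = m') → a j x lam m = a j x lam' m') :
    (∃ q ∈ Set.Ioo (0:ℝ) 1, ∀ k : K, ∀ s : X lastP → Bool,
      (1/q) * (∑ x : ∀ j, X j, if x lastP ≠ e lastP ∧ s (x lastP) then
            β k x * ∫ p, (∏ j, a j (x j) p.1 p.2) * ((b 0 p.2 + b 1 p.2) / 2)
              ∂((Measure.pi ρ).prod μ)
          else 0)
        + (1/(1-q)) * (∑ x : ∀ j, X j, if x lastP ≠ e lastP ∧ ¬ s (x lastP) then
            β k x * ∫ p, (∏ j, a j (x j) p.1 p.2) * ((b 0 p.2 - b 1 p.2) / 2)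
              ∂((Measure.pi ρ).prod μ)
          else 0)
        + (∑ x : ∀ j, X j, if x lastP = e lastP then
            β k x * ∫ p, (∏ j ∈ Finset.univ.erase lastP, a j (x j) p.1 p.2)
              ∂((Measure.pi ρ).prod μ)
          else 0) ≤ L k)
    ∨ (∀ k : K, ∀ s : X lastP → Bool,
        (∑ x : ∀ j, X j, if x lastP ≠ e lastP ∧ ¬ s (x lastP) then
            β k x * ∫ p, (∏ j, a j (x j) p.1 p.2) * ((b 0 p.2 - b 1 p.2) / 2)
              ∂((Measure.pi ρ).prod μ)
          else 0) = 0
        ∧ (∑ x : ∀ j, X j, if x lastP ≠ e lastP ∧ s (x lastP) then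
              β k x * ∫ p, (∏ j, a j (x j) p.1 p.2) * ((b 0 p.2 + b 1 p.2) / 2)
                ∂((Measure.pi ρ).prod μ)
            else 0)
          + (∑ x : ∀ j, X j, if x lastP = e lastP then
              β k x * ∫ p, (∏ j ∈ Finset.univ.erase lastP, a j (x j) p.1 p.2)
                ∂((Measure.pi ρ).prod μ)
            else 0) ≤ L k)
    ∨ (∀ k : K, ∀ s : X lastP → Bool,
        (∑ x : ∀ j, X j, if x lastP ≠ e lastP ∧ s (x lastP) then
            β k x * ∫ p, (∏ j, a j (x j) p.1 p.2) * ((b 0 p.2 + b 1 p.2) / 2)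
              ∂((Measure.pi ρ).prod μ)
          else 0) = 0
        ∧ (∑ x : ∀ j, X j, if x lastP ≠ e lastP ∧ ¬ s (x lastP) then
              β k x * ∫ p, (∏ j, a j (x j) p.1 p.2) * ((b 0 p.2 - b 1 p.2) / 2)
                ∂((Measure.pi ρ).prod μ)
            else 0)
          + (∑ x : ∀ j, X j, if x lastP = e lastP then
              β k x * ∫ p, (∏ j ∈ Finset.univ.erase lastP, a j (x j) p.1 p.2)
                ∂((Measure.pi ρ).prod μ)
            else 0) ≤ L k) := by
  classical
  have m₀ : Μt := (nonempty_of_isProbabilityMeasure μ).some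
  set f : (∀ j, X j) → (∀ i, Λ i) → Μt → ℝ := fun x lam m => ∏ j, a j (x j) lam m with hf_def
  have hf : ∀ x, Measurable fun p : (∀ i, Λ i) × Μt => f x p.1 p.2 := fun x =>
    Finset.measurable_fun_prod _ fun j _ => ha_meas j (x j)
  have hf1 : ∀ x lam m, |f x lam m| ≤ 1 := fun x lam m => by
    rw [hf_def, Finset.abs_prod]
    refine le_of_eq (Finset.prod_eq_one fun j _ => ?_)
    rcases ha_val j (x j) lam m with h | h <;> simp [h]
  have ha_indep : ∀ j, j ≠ lastP → ∀ x lam m m', a j x lam m = a j x lam m' :=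
    fun j hj x lam m m' => ha_loc j x lam lam m m' (fun _ _ => rfl) fun h => absurd h hj
  have marginal : ∀ x : ∀ j, X j, x lastP = e lastP → ∀ m lam m',
      ∏ j ∈ Finset.univ.erase lastP, a j (x j) lam m' = f x lam m := fun x hx m lam m' => by
    rw [hf_def]
    simp only
    rw [← Finset.mul_prod_erase _ _ (Finset.mem_univ lastP), hx, ha_triv, one_mul]
    exact Finset.prod_congr rfl fun j hj => ha_indep j (Finset.ne_of_mem_erase hj) _ _ _ _
  have huv : ∀ m, |(b 0 m + b 1 m) / 2| = 1 ∧ (b 0 m - b 1 m) / 2 = 0 ∨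
      (b 0 m + b 1 m) / 2 = 0 ∧ |(b 0 m - b 1 m) / 2| = 1 := fun m =>
    half_sum_half_diff_sign (hb_val 0 m) (hb_val 1 m)
  have hu : Measurable fun m => (b 0 m + b 1 m) / 2 := ((hb_meas 0).add (hb_meas 1)).div_const 2
  have hv : Measurable fun m => (b 0 m - b 1 m) / 2 := ((hb_meas 0).sub (hb_meas 1)).div_const 2
  have hu1 : ∀ m, |(b 0 m + b 1 m) / 2| ≤ 1 := fun m => by
    rcases huv m with h | h <;> simp [h]
  have hv1 : ∀ m, |(b 0 m - b 1 m) / 2| ≤ 1 := fun m => by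
    rcases huv m with h | h <;> simp [h]
  have key : ∀ (k : K) (s : X lastP → Bool) (m m' : Μt),
      |∑ x with x lastP ≠ e lastP ∧ s (x lastP), β k x * ∫ lam, f x lam m ∂(Measure.pi ρ)|
        + |∑ x with x lastP ≠ e lastP ∧ ¬ s (x lastP),
            β k x * ∫ lam, f x lam m' ∂(Measure.pi ρ)|
        + ((∑ x : ∀ j, X j, if x lastP = e lastP then
              β k x * ∫ p, (∏ j ∈ Finset.univ.erase lastP, a j (x j) p.1 p.2)
                ∂((Measure.pi ρ).prod μ)
            else 0) - L k) ≤ 0 := by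
    intro k s m m'
    refine abs_add_abs_add_le fun σ τ hσ hτ => ?_
    let w : ∀ j, X j → ℝ := Function.update (fun _ _ => 1) lastP
      fun y => if y = e lastP then 1 else if s y then σ else τ
    let n : ∀ j, X j → Μt := Function.update (fun _ _ => m) lastP
      fun y => if s y then m else m'
    have hw : ∀ j x, w j x = 1 ∨ w j x = -1 := fun j x => by
      by_cases hj : j = lastP
      · subst hj
        simp only [w, Function.update_self]
        split_ifs <;> simp [hσ, hτ]
      · simp [w, hj]
    have hprod : ∀ x lam, ∏ j, w j (x j) * a j (x j) lam (n j (x j))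
        = w lastP (x lastP) * f x lam (n lastP (x lastP)) := fun x lam => by
      rw [Finset.prod_mul_distrib, Finset.prod_eq_single_of_mem lastP (Finset.mem_univ _)
        fun j _ hj => by simp [w, hj]]
      congr 1
      refine Finset.prod_congr rfl fun j _ => ?_
      by_cases hj : j = lastP
      · subst hj; rfl
      · exact ha_indep j hj _ _ _ _
    have hB := hBell Λ ρ (fun j x lam => w j x * a j x lam (n j x))
      (fun j x => ((ha_meas j x).comp measurable_prodMk_right).const_mul _)
      (fun j x lam => by
        rcases hw j x with h | h <;> rcases ha_val j x lam (n j x) with h' | h' <;> simp [h, h'])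
      (fun j lam => by
        by_cases hj : j = lastP
        · subst hj; simp [w, ha_triv]
        · simp [w, hj, ha_triv])
      (fun j x lam lam' h => by
        rw [ha_loc j x lam lam' _ _ h fun _ => rfl]) k
    refine le_trans (le_of_eq ?_) hB
    simp only [hprod, integral_const_mul]
    rw [Finset.sum_filter, Finset.sum_filter, Finset.mul_sum, Finset.mul_sum,
      ← Finset.sum_add_distrib, ← Finset.sum_add_distrib]
    refine Finset.sum_congr rfl fun x _ => ?_
    by_cases hx : x lastP = e lastP
    · have h : ∫ p, (∏ j ∈ Finset.univ.erase lastP, a j (x j) p.1 p.2) ∂((Measure.pi ρ).prod μ)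
          = ∫ lam, f x lam (n lastP (x lastP)) ∂(Measure.pi ρ) := by
        simp only [marginal x hx (n lastP (x lastP))]
        rw [integral_fun_fst (μ := Measure.pi ρ) (ν := μ)
          (f := fun lam => f x lam (n lastP (x lastP)))]
        simp
      rw [h]
      simp [hx, w]
    · by_cases hs : s (x lastP) = true <;> simp [hx, hs, w, n] <;> ring
  have main := fun (k : K) (s : X lastP → Bool) =>
    have hG := sum_mul_integral_prod_eq (Measure.pi ρ) μ
      {x : ∀ j, X j | x lastP ≠ e lastP ∧ s (x lastP)} (β k) f _ hf hf1 hu hu1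
    have hH := sum_mul_integral_prod_eq (Measure.pi ρ) μ
      {x : ∀ j, X j | x lastP ≠ e lastP ∧ ¬ s (x lastP)} (β k) f _ hf hf1 hv hv1
    And.intro ((Finset.sum_filter _ _).symm.trans hG.2) <|
    And.intro ((Finset.sum_filter _ _).symm.trans hH.2) <|
      integral_sign_trichotomy μ _ _ _ _ _ hu hv huv hG.1 hH.1 (key k s)
  have hq0 : 0 ≤ ∫ m, |(b 0 m + b 1 m) / 2| ∂μ := integral_nonneg fun m => abs_nonneg _
  have hq1 : ∫ m, |(b 0 m + b 1 m) / 2| ∂μ ≤ 1 := by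
    refine (integral_mono_of_nonneg (.of_forall fun m => abs_nonneg _) (integrable_const 1)
      (.of_forall hu1)).trans (by simp)
  rcases hq0.eq_or_lt with h0 | h0
  · refine .inr (.inr fun k s => ?_)
    obtain ⟨e1, e2, -, -, h⟩ := main k s
    obtain ⟨h, h'⟩ := h h0.symm
    rw [← e1] at h
    rw [← e2] at h'
    exact ⟨h, by linarith⟩
  rcases hq1.eq_or_lt with h1 | h1
  · refine .inr (.inl fun k s => ?_)
    obtain ⟨e1, e2, -, h, -⟩ := main k s
    obtain ⟨h, h'⟩ := h h1
    rw [← e2] at h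
    rw [← e1] at h'
    exact ⟨h, by linarith⟩
  · refine .inl ⟨_, ⟨h0, h1⟩, fun k s => ?_⟩
    obtain ⟨e1, e2, h, -, -⟩ := main k s
    have h := h ⟨h0, h1⟩
    rw [← e1, ← e2] at h
    linarith
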